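/- Let P, Q ∈ ℂ[X₁,...,X₆] be polynomials in six variables. Suppose that P(a0, a2, b0, b1, b2, b3)(τ,z) = Q(c0, c1, c2, d0, d2, d3)(τ,z) for every τ ∈ ℍ with E4(τ)·E6(τ) ≠ 0 and every z ∈ ℂ⁴. Then P(â0, â2, b̂0, b̂1, b̂2, b̂3) = Q(ĉ0, ĉ1, ĉ2, d̂0, d̂2, d̂3) holds in the ring R. -/

import Mathlib

open MvPolynomial Complex

/-- `I2 = z1²+z2²+z3²+z4²` as a function on ℂ⁴ -/
noncomputable def fI2 (z : Fin 4 → ℂ) : ℂ := ∑ i, z i ^ 2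

/-- `I4 = Σ_{i<j} zi²zj²` as a function on ℂ⁴ -/
noncomputable def fI4 (z : Fin 4 → ℂ) : ℂ :=
  ∑ p ∈ Finset.univ.filter (fun p : Fin 4 × Fin 4 => p.1 < p.2), z p.1 ^ 2 * z p.2 ^ 2

/-- `I6 = Σ_{i<j<k} zi²zj²zk²` as a function on ℂ⁴ -/
noncomputable def fI6 (z : Fin 4 → ℂ) : ℂ :=
  ∑ p ∈ Finset.univ.filter (fun p : Fin 4 × Fin 4 × Fin 4 => p.1 < p.2.1 ∧ p.2.1 < p.2.2),
    z p.1 ^ 2 * z p.2.1 ^ 2 * z p.2.2 ^ 2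

/-- `Ĩ4 = z1z2z3z4` as a function on ℂ⁴ -/
noncomputable def fI4t (z : Fin 4 → ℂ) : ℂ := ∏ i, z i

/-- `T1 = I4/6 − I2²/24` -/
noncomputable def fT1 (z : Fin 4 → ℂ) : ℂ := fI4 z / 6 - fI2 z ^ 2 / 24

/-- `T2 = −I4/12 − Ĩ4/2 + I2²/48` -/
noncomputable def fT2 (z : Fin 4 → ℂ) : ℂ := -fI4 z / 12 - fI4t z / 2 + fI2 z ^ 2 / 48

/-- `T3 = −I4/12 + Ĩ4/2 + I2²/48` -/
noncomputable def fT3 (z : Fin 4 → ℂ) : ℂ := -fI4 z / 12 + fI4t z / 2 + fI2 z ^ 2 / 48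

/-- `θ2(τ) = Σ_{n∈ℤ} q^{(n−1/2)²/2}`, `q = e^{2πiτ}` -/
noncomputable def theta2 (τ : ℂ) : ℂ :=
  ∑' n : ℤ, Complex.exp (Real.pi * Complex.I * τ * ((n : ℂ) - 1 / 2) ^ 2)

/-- `θ3(τ) = Σ_{n∈ℤ} q^{n²/2}` -/
noncomputable def theta3 (τ : ℂ) : ℂ :=
  ∑' n : ℤ, Complex.exp (Real.pi * Complex.I * τ * (n : ℂ) ^ 2)

/-- `θ4(τ) = Σ_{n∈ℤ} (−1)ⁿ q^{n²/2}` -/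
noncomputable def theta4 (τ : ℂ) : ℂ :=
  ∑' n : ℤ, (-1 : ℂ) ^ n * Complex.exp (Real.pi * Complex.I * τ * (n : ℂ) ^ 2)

/-- `e1 = (θ3⁴+θ4⁴)/12` -/
noncomputable def e1 (τ : ℂ) : ℂ := (theta3 τ ^ 4 + theta4 τ ^ 4) / 12

/-- `e2 = (θ2⁴−θ4⁴)/12` -/
noncomputable def e2 (τ : ℂ) : ℂ := (theta2 τ ^ 4 - theta4 τ ^ 4) / 12

/-- `e3 = (−θ2⁴−θ3⁴)/12` -/
noncomputable def e3 (τ : ℂ) : ℂ := (-theta2 τ ^ 4 - theta3 τ ^ 4) / 12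

/-- `K = I2` -/
noncomputable def Kf (_τ : ℂ) (z : Fin 4 → ℂ) : ℂ := fI2 z

/-- `L = e1·T1 + e2·T2 + e3·T3` -/
noncomputable def Lf (τ : ℂ) (z : Fin 4 → ℂ) : ℂ :=
  e1 τ * fT1 z + e2 τ * fT2 z + e3 τ * fT3 z

/-- `M = 12(e1²·T1 + e2²·T2 + e3²·T3)` -/
noncomputable def Mf (τ : ℂ) (z : Fin 4 → ℂ) : ℂ :=
  12 * (e1 τ ^ 2 * fT1 z + e2 τ ^ 2 * fT2 z + e3 τ ^ 2 * fT3 z)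

/-- `N = I6/4 − I2·I4/24 + I2³/96` -/
noncomputable def Nf (_τ : ℂ) (z : Fin 4 → ℂ) : ℂ :=
  fI6 z / 4 - fI2 z * fI4 z / 24 + fI2 z ^ 3 / 96

/-- `q = e^{2πiτ}` -/
noncomputable def qc (τ : ℂ) : ℂ := Complex.exp (2 * Real.pi * Complex.I * τ)

/-- `E4(τ) = 1 + 240·Σ_{n≥1} n³qⁿ/(1−qⁿ)` -/
noncomputable def E4 (τ : ℂ) : ℂ :=
  1 + 240 * ∑' n : ℕ, ((n : ℂ) + 1) ^ 3 * qc τ ^ (n + 1) / (1 - qc τ ^ (n + 1))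

/-- `E6(τ) = 1 − 504·Σ_{n≥1} n⁵qⁿ/(1−qⁿ)` -/
noncomputable def E6 (τ : ℂ) : ℂ :=
  1 - 504 * ∑' n : ℕ, ((n : ℂ) + 1) ^ 5 * qc τ ^ (n + 1) / (1 - qc τ ^ (n + 1))

/-- `Δ = (E4³ − E6²)/1728` -/
noncomputable def Δf (τ : ℂ) : ℂ := (E4 τ ^ 3 - E6 τ ^ 2) / 1728

/-- `a0 = E4/12` -/
noncomputable def a0f (τ : ℂ) : ℂ := E4 τ / 12

/-- `a2 = ΔK²/(4E4) − E6·L/24 + E4·M/24` -/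
noncomputable def a2f (τ : ℂ) (z : Fin 4 → ℂ) : ℂ :=
  Δf τ * Kf τ z ^ 2 / (4 * E4 τ) - E6 τ * Lf τ z / 24 + E4 τ * Mf τ z / 24

/-- `b0 = E6/216` -/
noncomputable def b0f (τ : ℂ) : ℂ := E6 τ / 216

/-- `b1 = ΔK/E4` -/
noncomputable def b1f (τ : ℂ) (z : Fin 4 → ℂ) : ℂ := Δf τ * Kf τ z / E4 τ

/-- `b2 = −E6·ΔK²/(24E4²) − E4²·L/288 + E6·M/288` -/
noncomputable def b2f (τ : ℂ) (z : Fin 4 → ℂ) : ℂ :=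
  -(E6 τ * Δf τ * Kf τ z ^ 2) / (24 * E4 τ ^ 2) - E4 τ ^ 2 * Lf τ z / 288 + E6 τ * Mf τ z / 288

/-- `b3 = −Δ²K³/E4³ + ΔK·M/(4E4) + Δ·N/4` -/
noncomputable def b3f (τ : ℂ) (z : Fin 4 → ℂ) : ℂ :=
  -(Δf τ ^ 2 * Kf τ z ^ 3) / E4 τ ^ 3 + Δf τ * Kf τ z * Mf τ z / (4 * E4 τ) + Δf τ * Nf τ z / 4

/-- `c0 = E4/12` -/
noncomputable def c0f (τ : ℂ) : ℂ := E4 τ / 12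

/-- `c1 = −12·ΔK/E6` -/
noncomputable def c1f (τ : ℂ) (z : Fin 4 → ℂ) : ℂ := -12 * Δf τ * Kf τ z / E6 τ

/-- `c2 = E4²·ΔK²/(4E6²) − E6·L/24 + E4·M/24` -/
noncomputable def c2f (τ : ℂ) (z : Fin 4 → ℂ) : ℂ :=
  E4 τ ^ 2 * Δf τ * Kf τ z ^ 2 / (4 * E6 τ ^ 2) - E6 τ * Lf τ z / 24 + E4 τ * Mf τ z / 24

/-- `d0 = E6/216` -/
noncomputable def d0f (τ : ℂ) : ℂ := E6 τ / 216

/-- `d2 = −E4·ΔK²/(24E6) − E4²·L/288 + E6·M/288` -/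
noncomputable def d2f (τ : ℂ) (z : Fin 4 → ℂ) : ℂ :=
  -(E4 τ * Δf τ * Kf τ z ^ 2) / (24 * E6 τ) - E4 τ ^ 2 * Lf τ z / 288 + E6 τ * Mf τ z / 288

/-- `d3 = 2Δ²K³/E6² + E4·ΔK·L/(4E6) + Δ·N/4` -/
noncomputable def d3f (τ : ℂ) (z : Fin 4 → ℂ) : ℂ :=
  2 * Δf τ ^ 2 * Kf τ z ^ 3 / E6 τ ^ 2 + E4 τ * Δf τ * Kf τ z * Lf τ z / (4 * E6 τ) +
    Δf τ * Nf τ z / 4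

/-- The ring `R`: we realize the localization of `ℂ[α0,α1,α2,β0,β1,β2,β3]` at `α0, β0`
inside the fraction field, where `α0` and `β0` are invertible. -/
noncomputable abbrev Frac : Type := FractionRing (MvPolynomial (Fin 7) ℂ)

/-- `α0, α1, α2` (coefficients of the binary quadratic) -/
noncomputable def alph : ℕ → Frac
  | 0 => algebraMap (MvPolynomial (Fin 7) ℂ) Frac (X 0)
  | 1 => algebraMap (MvPolynomial (Fin 7) ℂ) Frac (X 1)
  | 2 => algebraMap (MvPolynomial (Fin 7) ℂ) Frac (X 2)
  | _ => 0

/-- `β0, β1, β2, β3` (coefficients of the binary cubic) -/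
noncomputable def bet : ℕ → Frac
  | 0 => algebraMap (MvPolynomial (Fin 7) ℂ) Frac (X 3)
  | 1 => algebraMap (MvPolynomial (Fin 7) ℂ) Frac (X 4)
  | 2 => algebraMap (MvPolynomial (Fin 7) ℂ) Frac (X 5)
  | 3 => algebraMap (MvPolynomial (Fin 7) ℂ) Frac (X 6)
  | _ => 0

/-- `â_i = Σ_{j=0}^{i} α_j · C(2−j, 2−i) · (−α1/(2α0))^{i−j}` -/
noncomputable def ahat (i : ℕ) : Frac :=
  ∑ j ∈ Finset.range (i + 1),
    alph j * (Nat.choose (2 - j) (2 - i) : Frac) * (-alph 1 / (2 * alph 0)) ^ (i - j)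

/-- `b̂_i = Σ_{j=0}^{i} β_j · C(3−j, 3−i) · (−α1/(2α0))^{i−j}` -/
noncomputable def bhat (i : ℕ) : Frac :=
  ∑ j ∈ Finset.range (i + 1),
    bet j * (Nat.choose (3 - j) (3 - i) : Frac) * (-alph 1 / (2 * alph 0)) ^ (i - j)

/-- `ĉ_i = Σ_{j=0}^{i} α_j · C(2−j, 2−i) · (−β1/(3β0))^{i−j}` -/
noncomputable def chat (i : ℕ) : Frac :=
  ∑ j ∈ Finset.range (i + 1),
    alph j * (Nat.choose (2 - j) (2 - i) : Frac) * (-bet 1 / (3 * bet 0)) ^ (i - j)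

/-- `d̂_i = Σ_{j=0}^{i} β_j · C(3−j, 3−i) · (−β1/(3β0))^{i−j}` -/
noncomputable def dhat (i : ℕ) : Frac :=
  ∑ j ∈ Finset.range (i + 1),
    bet j * (Nat.choose (3 - j) (3 - i) : Frac) * (-bet 1 / (3 * bet 0)) ^ (i - j)

open scoped UpperHalfPlane in
theorem tsum_lambert_eq_tsum_sigma (k : ℕ) (τ : ℍ) :
    ∑' n : ℕ, ((n : ℂ) + 1) ^ k * qc τ ^ (n + 1) / (1 - qc τ ^ (n + 1)) =
      ∑' n : ℕ+, (ArithmeticFunction.sigma k n : ℂ) * cexp (2 * Real.pi * I * τ) ^ (n : ℤ) := by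
  have h := tsum_pow_div_one_sub_eq_tsum_sigma (UpperHalfPlane.norm_exp_two_pi_I_lt_one τ) k
  simp only [zpow_natCast]
  rw [← h, tsum_pnat_eq_tsum_succ (f := fun n : ℕ ↦ (n : ℂ) ^ k *
    cexp (2 * Real.pi * I * τ) ^ n / (1 - cexp (2 * Real.pi * I * τ) ^ n))]
  simp [qc]

open scoped UpperHalfPlane in
theorem E4_coe (τ : ℍ) : E4 τ = ModularForm.E₄ τ := by
  rw [EisensteinSeries.q_expansion_bernoulli _ ⟨2, rfl⟩, E4, tsum_lambert_eq_tsum_sigma,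
    show bernoulli 4 = -1 / 30 by decide +kernel]
  norm_num

open scoped UpperHalfPlane in
theorem E6_coe (τ : ℍ) : E6 τ = ModularForm.E₆ τ := by
  rw [EisensteinSeries.q_expansion_bernoulli _ ⟨3, rfl⟩, E6, tsum_lambert_eq_tsum_sigma,
    show bernoulli 6 = 1 / 42 by decide +kernel]
  norm_num

theorem differentiableOn_E4 : DifferentiableOn ℂ E4 {τ | 0 < τ.im} :=
  (UpperHalfPlane.mdifferentiable_iff.mp ModularForm.E₄.holo').congr fun τ hτ ↦ by
    simpa [UpperHalfPlane.ofComplex_apply_of_im_pos hτ] using E4_coe ⟨τ, hτ⟩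

theorem differentiableOn_E6 : DifferentiableOn ℂ E6 {τ | 0 < τ.im} :=
  (UpperHalfPlane.mdifferentiable_iff.mp ModularForm.E₆.holo').congr fun τ hτ ↦ by
    simpa [UpperHalfPlane.ofComplex_apply_of_im_pos hτ] using E6_coe ⟨τ, hτ⟩

theorem qc_add_natCast (τ : ℂ) (n : ℕ) : qc (τ + n) = qc τ := by
  rw [qc, qc, Complex.exp_eq_exp_iff_exists_int]
  exact ⟨n, by push_cast; ring⟩

theorem E4_add_natCast (τ : ℂ) (n : ℕ) : E4 (τ + n) = E4 τ := by
  simp [E4, qc_add_natCast]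

theorem E6_add_natCast (τ : ℂ) (n : ℕ) : E6 (τ + n) = E6 τ := by
  simp [E6, qc_add_natCast]

theorem im_neg_inv_pos {τ : ℂ} (hτ : 0 < τ.im) : 0 < (-τ⁻¹).im := by
  have h := UpperHalfPlane.im_inv_neg_coe_pos ⟨τ, hτ⟩
  rwa [← neg_inv] at h

open scoped UpperHalfPlane MatrixGroups in
theorem modularForm_neg_inv {k : ℕ} (f : ModularForm 𝒮ℒ k) {τ : ℂ} (hτ : 0 < τ.im) :
    f ⟨-τ⁻¹, im_neg_inv_pos hτ⟩ = τ ^ k * f ⟨τ, hτ⟩ := by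
  have : SlashInvariantFormClass (ModularForm 𝒮ℒ k) (CongruenceSubgroup.Gamma 1) k :=
    CongruenceSubgroup.Gamma_one_coe_eq_SL ▸ inferInstance
  have h := SlashInvariantForm.slash_action_eqn_SL'' f
    (CongruenceSubgroup.mem_Gamma_one ModularGroup.S) ⟨τ, hτ⟩
  rw [UpperHalfPlane.modular_S_smul, ModularGroup.denom_S, zpow_natCast] at h
  simpa using h

theorem E4_neg_inv {τ : ℂ} (hτ : 0 < τ.im) : E4 (-τ⁻¹) = τ ^ 4 * E4 τ := by
  have h := modularForm_neg_inv (k := 4) ModularForm.E₄ hτ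
  rwa [← E4_coe, ← E4_coe] at h

theorem E6_neg_inv {τ : ℂ} (hτ : 0 < τ.im) : E6 (-τ⁻¹) = τ ^ 6 * E6 τ := by
  have h := modularForm_neg_inv (k := 6) ModularForm.E₆ hτ
  rwa [← E6_coe, ← E6_coe] at h

theorem eqOn_zero_of_imaginary_ray {f : ℂ → ℂ} (hf : DifferentiableOn ℂ f {τ | 0 < τ.im}) {T : ℝ}
    (hT : 0 ≤ T) (h : ∀ t : ℝ, T < t → f (t * I) = 0) {τ : ℂ} (hτ : 0 < τ.im) : f τ = 0 := by
  have ho : IsOpen {τ : ℂ | 0 < τ.im} := isOpen_lt continuous_const Complex.continuous_im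
  refine (hf.analyticOnNhd ho).eqOn_zero_of_preconnected_of_frequently_eq_zero
    (z₀ := ((T + 1 : ℝ) : ℂ) * I) ?_ ?_ ?_ hτ
  · exact (convex_halfSpace_im_gt 0).isPreconnected
  · simp; positivity
  · have h1 : Filter.Tendsto (fun t : ℝ ↦ (t : ℂ) * I) (nhdsWithin (T + 1) {T + 1}ᶜ)
        (nhdsWithin (((T + 1 : ℝ) : ℂ) * I) {((T + 1 : ℝ) : ℂ) * I}ᶜ) := by
      refine tendsto_nhdsWithin_of_tendsto_nhds_of_eventually_within _ ?_ ?_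
      · exact ((by fun_prop : Continuous fun t : ℝ ↦ (t : ℂ) * I).tendsto _).mono_left
          nhdsWithin_le_nhds
      · filter_upwards [self_mem_nhdsWithin] with t ht
        simpa [Complex.ext_iff] using ht
    refine h1.frequently (Filter.Eventually.frequently ?_)
    filter_upwards [nhdsWithin_le_nhds (Ioi_mem_nhds (lt_add_one T))] with t ht
    exact h t ht

theorem E4_ray_ne_zero {t : ℝ} (ht : 0 < t) : E4 (t * I) ≠ 0 := by
  have hq : qc (t * I) = (Real.exp (-(2 * Real.pi * t)) : ℝ) := by
    rw [qc, Complex.ofReal_exp]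
    congr 1
    push_cast
    linear_combination (2 * Real.pi * t : ℂ) * I_mul_I
  have hr : Real.exp (-(2 * Real.pi * t)) < 1 := by
    rw [Real.exp_lt_one_iff]
    have := Real.pi_pos
    simp only [neg_neg_iff_pos]; positivity
  have hr0 := Real.exp_pos (-(2 * Real.pi * t))
  generalize Real.exp (-(2 * Real.pi * t)) = r at *
  have hs : E4 (t * I) =
      ((1 + 240 * ∑' n : ℕ, ((n : ℝ) + 1) ^ 3 * r ^ (n + 1) / (1 - r ^ (n + 1)) : ℝ) : ℂ) := by
    simp [E4, hq, Complex.ofReal_tsum]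
  rw [hs, Complex.ofReal_ne_zero]
  have : 0 ≤ ∑' n : ℕ, ((n : ℝ) + 1) ^ 3 * r ^ (n + 1) / (1 - r ^ (n + 1)) :=
    tsum_nonneg fun n ↦ div_nonneg (by positivity)
      (sub_nonneg.mpr (pow_le_one₀ hr0.le hr.le))
  positivity

theorem E6_I : E6 I = 0 := by
  have h := E6_neg_inv (τ := I) (by simp)
  rw [Complex.inv_I, neg_neg, show I ^ 6 = (I ^ 2) ^ 3 by ring, I_sq] at h
  linear_combination h / 2

theorem exists_E6_ray_ne_zero : ∃ t : ℝ, 1 < t ∧ E6 (t * I) ≠ 0 := by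
  by_contra! h
  refine EisensteinSeries.E_ne_zero (k := 6) (by norm_num) ⟨3, rfl⟩ ?_
  ext τ
  rw [← E6_coe]
  exact eqOn_zero_of_imaginary_ray differentiableOn_E6 zero_le_one h τ.im_pos

theorem MvPolynomial.differentiableOn_eval {σ : Type*} {s : Set ℂ} {f : ℂ → σ → ℂ}
    (hf : ∀ i, DifferentiableOn ℂ (fun τ ↦ f τ i) s) (p : MvPolynomial σ ℂ) :
    DifferentiableOn ℂ (fun τ ↦ eval (f τ) p) s := by
  induction p using MvPolynomial.induction_on with
  | C a => simp
  | add p q hp hq =>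
    simp only [map_add]
    exact hp.add hq
  | mul_X p i hp =>
    simp only [map_mul, eval_X]
    exact hp.mul (hf i)

theorem MvPolynomial.eval_eval_aeval {σ : Type*} (v : σ → Polynomial ℂ) (s : ℂ)
    (g : MvPolynomial σ ℂ) :
    (aeval v g).eval s = eval (fun i ↦ (v i).eval s) g := by
  simpa [coe_aeval_eq_eval] using comp_aeval_apply v (Polynomial.aeval s : Polynomial ℂ →ₐ[ℂ] ℂ) g

theorem eval_E4_E6_scaled {g : MvPolynomial (Fin 2) ℂ}
    (h : ∀ τ : ℂ, 0 < τ.im → eval ![E4 τ, E6 τ] g = 0) {τ : ℂ} (hτ : 0 < τ.im) (s : ℂ) :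
    eval ![s ^ 4 * E4 τ, s ^ 6 * E6 τ] g = 0 := by
  let v : Fin 2 → Polynomial ℂ :=
    ![Polynomial.X ^ 4 * Polynomial.C (E4 τ), Polynomial.X ^ 6 * Polynomial.C (E6 τ)]
  have hv (s : ℂ) : (aeval v g).eval s = eval ![s ^ 4 * E4 τ, s ^ 6 * E6 τ] g := by
    rw [eval_eval_aeval]
    congr 2
    ext i
    fin_cases i <;> simp [v] <;> ring
  suffices aeval v g = 0 by rw [← hv, this, Polynomial.eval_zero]
  refine Polynomial.eq_zero_of_infinite_isRoot _
    ((Set.infinite_range_of_injective (f := fun n : ℕ ↦ τ + n) fun m n hmn ↦ ?_).mono ?_)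
  · simpa using hmn
  · rintro _ ⟨n, rfl⟩
    have hn : 0 < (τ + n).im := by simpa using hτ
    have := h _ (im_neg_inv_pos hn)
    rw [E4_neg_inv hn, E6_neg_inv hn, E4_add_natCast, E6_add_natCast, ← hv] at this
    exact this

theorem infinite_E6_sq_div_E4_cube :
    ((fun t : ℝ ↦ E6 (t * I) ^ 2 / E4 (t * I) ^ 3) '' Set.Ici 1).Infinite := by
  have hray {f : ℂ → ℂ} (hf : DifferentiableOn ℂ f {τ | 0 < τ.im}) :
      ContinuousOn (fun t : ℝ ↦ f (t * I)) (Set.Ici 1) :=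
    hf.continuousOn.comp (by fun_prop) fun t ht ↦ by
      simpa using zero_lt_one.trans_le (Set.mem_Ici.mp ht)
  obtain ⟨t, ht, ht'⟩ := exists_E6_ray_ne_zero
  have hE4 {t : ℝ} (ht : 1 ≤ t) : E4 (t * I) ≠ 0 := E4_ray_ne_zero (zero_lt_one.trans_le ht)
  refine (isPreconnected_Ici.image _ <| ((hray differentiableOn_E6).pow 2).div
    ((hray differentiableOn_E4).pow 3) fun t ht ↦ pow_ne_zero 3 (hE4 ht)).infinite_of_nontrivial
    ⟨_, ⟨1, Set.self_mem_Ici, rfl⟩, _, ⟨t, ht.le, rfl⟩, ?_⟩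
  simpa [E6_I] using (div_ne_zero (pow_ne_zero 2 ht') (pow_ne_zero 3 (hE4 ht.le))).symm

theorem eq_zero_of_eval_E4_E6_ray {g : MvPolynomial (Fin 2) ℂ} {T : ℝ} (hT : 0 ≤ T)
    (h : ∀ t : ℝ, T < t → eval ![E4 (t * I), E6 (t * I)] g = 0) : g = 0 := by
  have hscaled {τ : ℂ} (hτ : 0 < τ.im) (s : ℂ) : eval ![s ^ 4 * E4 τ, s ^ 6 * E6 τ] g = 0 := by
    have hd : DifferentiableOn ℂ (fun τ ↦ eval ![E4 τ, E6 τ] g) {τ | 0 < τ.im} :=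
      MvPolynomial.differentiableOn_eval
        (Fin.forall_fin_two.mpr ⟨differentiableOn_E4, differentiableOn_E6⟩) g
    exact eval_E4_E6_scaled (fun τ hτ ↦ eqOn_zero_of_imaginary_ray hd hT h hτ) hτ s
  suffices X 0 * g = 0 from (mul_eq_zero.mp this).resolve_left (X_ne_zero 0)
  refine MvPolynomial.funext fun x ↦ ?_
  rw [map_mul, eval_X, map_zero, mul_eq_zero, or_iff_not_imp_left]
  intro hx
  let v : Fin 2 → Polynomial ℂ := ![Polynomial.C (x 0), Polynomial.X]
  have hv (y : ℂ) : (aeval v g).eval y = eval ![x 0, y] g := by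
    rw [eval_eval_aeval]
    congr 2
    ext i
    fin_cases i <;> simp [v]
  suffices aeval v g = 0 by
    have hx1 := hv (x 1)
    rw [this, Polynomial.eval_zero] at hx1
    rw [hx1]
    congr 2
    ext i
    fin_cases i <;> rfl
  refine Polynomial.eq_zero_of_infinite_isRoot _
    (Set.Infinite.of_image (fun y ↦ y ^ 2 / x 0 ^ 3) (infinite_E6_sq_div_E4_cube.mono ?_))
  rintro _ ⟨t, ht, rfl⟩
  have ht0 : 0 < t := zero_lt_one.trans_le ht
  have hE4 := E4_ray_ne_zero ht0
  obtain ⟨s, hs⟩ := IsAlgClosed.exists_pow_nat_eq (x 0 / E4 (t * I)) (n := 4) (by norm_num)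
  have hs' : s ^ 4 * E4 (t * I) = x 0 := by rw [hs]; field_simp
  refine ⟨s ^ 6 * E6 (t * I), ?_, ?_⟩
  · have := hscaled (τ := t * I) (by simpa using ht0) s
    rwa [hs', ← hv] at this
  · have hs0 : s ≠ 0 := by
      rintro rfl
      exact hx (by simpa using hs'.symm)
    simp only [← hs']
    field_simp

theorem cexp_pi_I_ray (t x : ℝ) :
    cexp (Real.pi * I * (t * I) * (x : ℂ) ^ 2) = (Real.exp (-Real.pi * x ^ 2 * t) : ℝ) := by
  rw [Complex.ofReal_exp]
  congr 1
  push_cast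
  linear_combination (Real.pi * t * x ^ 2 : ℂ) * I_mul_I

theorem theta2_ray {t : ℝ} (ht : 0 < t) :
    theta2 (t * I) = (HurwitzZeta.evenKernel ((-1 / 2 : ℝ) : UnitAddCircle) t : ℝ) := by
  rw [← (HurwitzZeta.hasSum_int_evenKernel (-1 / 2) ht).tsum_eq, Complex.ofReal_tsum, theta2]
  refine tsum_congr fun n ↦ ?_
  rw [← cexp_pi_I_ray]
  congr 2
  push_cast
  ring

theorem theta3_ray {t : ℝ} (ht : 0 < t) :
    theta3 (t * I) = (HurwitzZeta.evenKernel ((0 : ℝ) : UnitAddCircle) t : ℝ) := by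
  rw [← (HurwitzZeta.hasSum_int_evenKernel 0 ht).tsum_eq, Complex.ofReal_tsum, theta3]
  refine tsum_congr fun n ↦ ?_
  rw [← cexp_pi_I_ray]
  simp

theorem exists_theta4_ray {t : ℝ} (ht : 0 < t) :
    ∃ r : ℝ, |r| ≤ HurwitzZeta.evenKernel ((0 : ℝ) : UnitAddCircle) t ∧ theta4 (t * I) = r := by
  have hs := HurwitzZeta.hasSum_int_evenKernel 0 ht
  refine ⟨∑' n : ℤ, (-1 : ℝ) ^ n * Real.exp (-Real.pi * (n + 0) ^ 2 * t), ?_, ?_⟩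
  · rw [← Real.norm_eq_abs]
    exact tsum_of_norm_bounded hs fun n ↦ by simp
  · rw [Complex.ofReal_tsum, theta4]
    refine tsum_congr fun n ↦ ?_
    rw [Complex.ofReal_mul, ← cexp_pi_I_ray]
    simp

theorem exists_ray_discriminant_ne_zero : ∃ T : ℝ, 0 ≤ T ∧ ∀ t : ℝ, T < t →
    (e1 (t * I) - e3 (t * I)) * (e2 (t * I) - e3 (t * I)) * (e2 (t * I) - e1 (t * I)) ≠ 0 := by
  have hlim : Filter.Tendsto (HurwitzZeta.evenKernel ((-1 / 2 : ℝ) : UnitAddCircle))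
      Filter.atTop (nhds 0) := by
    obtain ⟨p, hp, hO⟩ := HurwitzZeta.isBigO_atTop_evenKernel_sub ((-1 / 2 : ℝ) : UnitAddCircle)
    have hne : ((-1 / 2 : ℝ) : UnitAddCircle) ≠ 0 := by
      rw [Ne, AddCircle.coe_eq_zero_iff]
      rintro ⟨n, hn⟩
      have h2 : (2 * n : ℝ) = -1 := by simp at hn; linarith
      norm_cast at h2
      omega
    simp only [hne, if_false, sub_zero] at hO
    refine hO.trans_tendsto (Real.tendsto_exp_atBot.comp ?_)
    exact Filter.tendsto_id.const_mul_atTop_of_neg (neg_neg_of_pos hp)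
  obtain ⟨T, hT⟩ := Filter.eventually_atTop.mp (hlim.eventually (gt_mem_nhds zero_lt_one))
  refine ⟨max T 0, le_max_right _ _, fun t ht ↦ ?_⟩
  obtain ⟨htT, ht0⟩ := max_lt_iff.mp ht
  obtain ⟨r, hr, h4⟩ := exists_theta4_ray ht0
  have h2 := hT t htT.le
  have h2pos : 0 < HurwitzZeta.evenKernel ((-1 / 2 : ℝ) : UnitAddCircle) t :=
    (Real.exp_pos _).trans_le
      (le_hasSum (HurwitzZeta.hasSum_int_evenKernel (-1 / 2) ht0) 0 fun _ _ ↦ by positivity)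
  have h3 : 1 ≤ HurwitzZeta.evenKernel ((0 : ℝ) : UnitAddCircle) t := by
    simpa using le_hasSum (HurwitzZeta.hasSum_int_evenKernel 0 ht0) 0 fun _ _ ↦ by positivity
  rw [e1, e2, e3, theta2_ray ht0, theta3_ray ht0, h4]
  generalize HurwitzZeta.evenKernel ((-1 / 2 : ℝ) : UnitAddCircle) t = x at *
  generalize HurwitzZeta.evenKernel ((0 : ℝ) : UnitAddCircle) t = y at *
  norm_cast
  have hry : r ^ 4 ≤ y ^ 4 := by
    rw [← Even.pow_abs ⟨2, rfl⟩]
    gcongr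
  have hxy : x ^ 4 < y ^ 4 := by gcongr; linarith
  have hx : 0 < x ^ 4 := by positivity
  have hr : 0 ≤ r ^ 4 := by positivity
  refine mul_ne_zero (mul_ne_zero ?_ ?_) ?_ <;> norm_cast
  · refine ne_of_gt ?_
    linarith
  · refine ne_of_gt ?_
    linarith
  · refine ne_of_lt ?_
    linarith

theorem exists_esymm_eq (a b c d : ℂ) : ∃ w₀ w₁ w₂ w₃ : ℂ,
    w₀ + w₁ + w₂ + w₃ = a ∧
    w₀ * w₁ + w₀ * w₂ + w₀ * w₃ + w₁ * w₂ + w₁ * w₃ + w₂ * w₃ = b ∧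
    w₀ * w₁ * w₂ + w₀ * w₁ * w₃ + w₀ * w₂ * w₃ + w₁ * w₂ * w₃ = c ∧
    w₀ * w₁ * w₂ * w₃ = d := by
  obtain ⟨w₀, h₀⟩ : ∃ w, w ^ 4 - a * w ^ 3 + b * w ^ 2 - c * w + d = 0 := by
    obtain ⟨w, hw⟩ := IsAlgClosed.exists_root (Polynomial.X ^ 4 -
      Polynomial.C a * Polynomial.X ^ 3 + Polynomial.C b * Polynomial.X ^ 2 -
      Polynomial.C c * Polynomial.X + Polynomial.C d)
      (by rw [show Polynomial.degree _ = 4 by compute_degree!]; norm_num)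
    exact ⟨w, by simpa using hw⟩
  let a' := a - w₀
  let b' := b - w₀ * a'
  let c' := c - w₀ * b'
  obtain ⟨w₁, h₁⟩ : ∃ w, w ^ 3 - a' * w ^ 2 + b' * w - c' = 0 := by
    obtain ⟨w, hw⟩ := IsAlgClosed.exists_root (Polynomial.X ^ 3 -
      Polynomial.C a' * Polynomial.X ^ 2 + Polynomial.C b' * Polynomial.X - Polynomial.C c')
      (by rw [show Polynomial.degree _ = 3 by compute_degree!]; norm_num)
    exact ⟨w, by simpa using hw⟩
  let a'' := a' - w₁
  let b'' := b' - w₁ * a''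
  obtain ⟨w₂, h₂⟩ : ∃ w, w ^ 2 - a'' * w + b'' = 0 := by
    obtain ⟨w, hw⟩ := IsAlgClosed.exists_root (Polynomial.X ^ 2 - Polynomial.C a'' * Polynomial.X +
      Polynomial.C b'') (by rw [show Polynomial.degree _ = 2 by compute_degree!]; norm_num)
    exact ⟨w, by simpa using hw⟩
  simp only [a'', b'', a', b', c'] at h₁ h₂
  refine ⟨w₀, w₁, w₂, a - w₀ - w₁ - w₂, by ring, ?_, ?_, ?_⟩
  · linear_combination -h₂
  · linear_combination h₁ - (w₀ + w₁) * h₂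
  · linear_combination -h₀ + w₀ * h₁ - w₀ * w₁ * h₂

theorem fI4_eq (z : Fin 4 → ℂ) : fI4 z = z 0 ^ 2 * z 1 ^ 2 + z 0 ^ 2 * z 2 ^ 2 +
    z 0 ^ 2 * z 3 ^ 2 + z 1 ^ 2 * z 2 ^ 2 + z 1 ^ 2 * z 3 ^ 2 + z 2 ^ 2 * z 3 ^ 2 := by
  simp [fI4, Finset.sum_filter, Fintype.sum_prod_type, Fin.sum_univ_four]
  ring

theorem fI6_eq (z : Fin 4 → ℂ) : fI6 z = z 0 ^ 2 * z 1 ^ 2 * z 2 ^ 2 +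
    z 0 ^ 2 * z 1 ^ 2 * z 3 ^ 2 + z 0 ^ 2 * z 2 ^ 2 * z 3 ^ 2 + z 1 ^ 2 * z 2 ^ 2 * z 3 ^ 2 := by
  simp [fI6, Finset.sum_filter, Fintype.sum_prod_type, Fin.sum_univ_four]

theorem exists_invariants_eq (a b c d : ℂ) :
    ∃ z : Fin 4 → ℂ, fI2 z = a ∧ fI4 z = b ∧ fI6 z = c ∧ fI4t z = d := by
  obtain ⟨w₀, w₁, w₂, w₃, ha, hb, hc, hd⟩ := exists_esymm_eq a b c (d ^ 2)
  obtain ⟨z₀, rfl⟩ := IsAlgClosed.exists_pow_nat_eq w₀ (n := 2) (by norm_num)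
  obtain ⟨z₁, rfl⟩ := IsAlgClosed.exists_pow_nat_eq w₁ (n := 2) (by norm_num)
  obtain ⟨z₂, rfl⟩ := IsAlgClosed.exists_pow_nat_eq w₂ (n := 2) (by norm_num)
  obtain ⟨z₃, rfl⟩ := IsAlgClosed.exists_pow_nat_eq w₃ (n := 2) (by norm_num)
  have hd' : (z₀ * z₁ * z₂ * z₃) ^ 2 = d ^ 2 := by rw [← hd]; ring
  rcases sq_eq_sq_iff_eq_or_eq_neg.mp hd' with h | h
  · refine ⟨![z₀, z₁, z₂, z₃], ?_⟩
    simpa [fI2, fI4_eq, fI6_eq, fI4t, Fin.sum_univ_four, Fin.prod_univ_four] using ⟨ha, hb, hc, h⟩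
  · refine ⟨![-z₀, z₁, z₂, z₃], ?_⟩
    simpa [fI2, fI4_eq, fI6_eq, fI4t, Fin.sum_univ_four, Fin.prod_univ_four] using
      ⟨ha, hb, hc, neg_eq_iff_eq_neg.mpr h⟩

theorem exists_KLMN_eq {τ : ℂ} (hτ : (e1 τ - e3 τ) * (e2 τ - e3 τ) * (e2 τ - e1 τ) ≠ 0)
    (k l m n : ℂ) :
    ∃ z : Fin 4 → ℂ, Kf τ z = k ∧ Lf τ z = l ∧ Mf τ z = m ∧ Nf τ z = n := by
  obtain ⟨⟨h13, h23⟩, h21⟩ : (e1 τ - e3 τ ≠ 0 ∧ e2 τ - e3 τ ≠ 0) ∧ e2 τ - e1 τ ≠ 0 := by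
    simpa only [mul_ne_zero_iff] using hτ
  let x := (l * (e2 τ + e3 τ) - m / 12) / ((e1 τ - e3 τ) * (e2 τ - e1 τ))
  let y := (m / 12 - l * (e1 τ + e3 τ)) / ((e2 τ - e3 τ) * (e2 τ - e1 τ))
  have hl : (e1 τ - e3 τ) * x + (e2 τ - e3 τ) * y = l := by
    simp only [x, y]
    field_simp
    ring
  have hm : (e1 τ ^ 2 - e3 τ ^ 2) * x + (e2 τ ^ 2 - e3 τ ^ 2) * y = m / 12 := by
    simp only [x, y]
    field_simp
    ring
  obtain ⟨z, h2, h4, h6, h4t⟩ := exists_invariants_eq k (6 * x + k ^ 2 / 4)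
    (4 * (n + k * (6 * x + k ^ 2 / 4) / 24 - k ^ 3 / 96)) (-x - 2 * y)
  have hT1 : fT1 z = x := by rw [fT1, h2, h4]; ring
  have hT2 : fT2 z = y := by rw [fT2, h2, h4, h4t]; ring
  have hT3 : fT3 z = -x - y := by rw [fT3, h2, h4, h4t]; ring
  refine ⟨z, h2, ?_, ?_, ?_⟩
  · rw [Lf, hT1, hT2, hT3]
    linear_combination hl
  · rw [Mf, hT1, hT2, hT3]
    linear_combination 12 * hm
  · rw [Nf, h2, h4, h6]
    ring

/-- The polynomial `(X₀³ - X₁²) / 1728`, which specializes to `Δ` at `X₀ = E4`, `X₁ = E6`. -/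
noncomputable def discPoly : MvPolynomial (Fin 6) ℂ := C (1 / 1728) * (X 0 ^ 3 - X 1 ^ 2)

/-- The polynomials giving `a0, a2, b0, b1, b2, b3` in terms of `E4, E6, K / (E4 E6), L, M, N`. -/
noncomputable def quadraticPoly : Fin 6 → MvPolynomial (Fin 6) ℂ :=
  ![C (1 / 12) * X 0,
    C (1 / 4) * discPoly * X 0 * X 1 ^ 2 * X 2 ^ 2 + C (1 / 24) * (X 0 * X 4 - X 1 * X 3),
    C (1 / 216) * X 1,
    discPoly * X 1 * X 2,
    C (-1 / 24) * X 1 ^ 3 * discPoly * X 2 ^ 2 + C (1 / 288) * (X 1 * X 4 - X 0 ^ 2 * X 3),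
    -discPoly ^ 2 * X 1 ^ 3 * X 2 ^ 3 + C (1 / 4) * discPoly * (X 1 * X 2 * X 4 + X 5)]

/-- The polynomials giving `c0, c1, c2, d0, d2, d3` in terms of `E4, E6, K / (E4 E6), L, M, N`. -/
noncomputable def cubicPoly : Fin 6 → MvPolynomial (Fin 6) ℂ :=
  ![C (1 / 12) * X 0,
    -12 * discPoly * X 0 * X 2,
    C (1 / 4) * X 0 ^ 4 * discPoly * X 2 ^ 2 + C (1 / 24) * (X 0 * X 4 - X 1 * X 3),
    C (1 / 216) * X 1,
    C (-1 / 24) * X 0 ^ 3 * X 1 * discPoly * X 2 ^ 2 + C (1 / 288) * (X 1 * X 4 - X 0 ^ 2 * X 3),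
    2 * discPoly ^ 2 * X 0 ^ 3 * X 1 * X 2 ^ 3 +
      C (1 / 4) * discPoly * (X 0 ^ 2 * X 2 * X 3 + X 5)]

theorem eval_quadraticPoly {τ : ℂ} {z : Fin 4 → ℂ} {k : ℂ} (h4 : E4 τ ≠ 0) (h6 : E6 τ ≠ 0)
    (hk : Kf τ z = E4 τ * E6 τ * k) :
    (fun i ↦ eval ![E4 τ, E6 τ, k, Lf τ z, Mf τ z, Nf τ z] (quadraticPoly i)) =
      ![a0f τ, a2f τ z, b0f τ, b1f τ z, b2f τ z, b3f τ z] := by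
  ext i
  fin_cases i <;>
    simp [quadraticPoly, discPoly, a0f, a2f, b0f, b1f, b2f, b3f, Δf, hk] <;> field_simp <;> ring

theorem eval_cubicPoly {τ : ℂ} {z : Fin 4 → ℂ} {k : ℂ} (h4 : E4 τ ≠ 0) (h6 : E6 τ ≠ 0)
    (hk : Kf τ z = E4 τ * E6 τ * k) :
    (fun i ↦ eval ![E4 τ, E6 τ, k, Lf τ z, Mf τ z, Nf τ z] (cubicPoly i)) =
      ![c0f τ, c1f τ z, c2f τ z, d0f τ, d2f τ z, d3f τ z] := by
  ext i
  fin_cases i <;>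
    simp [cubicPoly, discPoly, c0f, c1f, c2f, d0f, d2f, d3f, Δf, hk] <;> field_simp <;> ring

theorem eq_zero_of_eval_E4_E6 {G : MvPolynomial (Fin 6) ℂ} {T : ℝ} (hT : 0 ≤ T)
    (h : ∀ t : ℝ, T < t → E4 (t * I) * E6 (t * I) ≠ 0 → ∀ k l m n : ℂ,
      eval ![E4 (t * I), E6 (t * I), k, l, m, n] G = 0) : G = 0 := by
  suffices X 0 * X 1 * G = 0 from
    (mul_eq_zero.mp this).resolve_left (mul_ne_zero (X_ne_zero 0) (X_ne_zero 1))
  refine MvPolynomial.funext fun x ↦ ?_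
  let v : Fin 6 → MvPolynomial (Fin 2) ℂ := ![X 0, X 1, C (x 2), C (x 3), C (x 4), C (x 5)]
  have hv (a b : ℂ) : eval ![a, b] (aeval v (X 0 * X 1 * G)) =
      a * b * eval ![a, b, x 2, x 3, x 4, x 5] G := by
    have h := comp_aeval_apply v (aeval ![a, b] : MvPolynomial (Fin 2) ℂ →ₐ[ℂ] ℂ) (X 0 * X 1 * G)
    have hw : (fun i ↦ aeval ![a, b] (v i)) = ![a, b, x 2, x 3, x 4, x 5] := by
      ext i
      fin_cases i <;> simp [v]
    rw [hw] at h
    simpa [coe_aeval_eq_eval] using h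
  have hzero : aeval v (X 0 * X 1 * G) = 0 := by
    refine eq_zero_of_eval_E4_E6_ray hT fun t ht ↦ ?_
    rw [hv, mul_eq_zero, or_iff_not_imp_left]
    exact fun hne ↦ h t ht hne _ _ _ _
  have hx := hv (x 0) (x 1)
  rw [hzero, map_zero] at hx
  have hx' : ![x 0, x 1, x 2, x 3, x 4, x 5] = x := by
    ext i
    fin_cases i <;> rfl
  rw [hx'] at hx
  simpa using hx.symm

theorem aeval_quadraticPoly_eq_aeval_cubicPoly {P Q : MvPolynomial (Fin 6) ℂ}
    (h : ∀ τ : ℂ, 0 < τ.im → E4 τ * E6 τ ≠ 0 → ∀ z : Fin 4 → ℂ,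
      eval ![a0f τ, a2f τ z, b0f τ, b1f τ z, b2f τ z, b3f τ z] P
        = eval ![c0f τ, c1f τ z, c2f τ z, d0f τ, d2f τ z, d3f τ z] Q) :
    aeval quadraticPoly P = aeval cubicPoly Q := by
  obtain ⟨T, hT, hdisc⟩ := exists_ray_discriminant_ne_zero
  refine sub_eq_zero.mp (eq_zero_of_eval_E4_E6 hT fun t ht hne k l m n ↦ ?_)
  obtain ⟨z, hk, rfl, rfl, rfl⟩ :=
    exists_KLMN_eq (hdisc t ht) (E4 (t * I) * E6 (t * I) * k) l m n
  obtain ⟨h4, h6⟩ := mul_ne_zero_iff.mp hne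
  have hcomp (v : Fin 6 → MvPolynomial (Fin 6) ℂ) (x : Fin 6 → ℂ) (p : MvPolynomial (Fin 6) ℂ) :
      eval x (aeval v p) = eval (fun i ↦ eval x (v i)) p := by
    simpa [coe_aeval_eq_eval] using comp_aeval_apply v (aeval x : MvPolynomial (Fin 6) ℂ →ₐ[ℂ] ℂ) p
  rw [map_sub, hcomp, hcomp, eval_quadraticPoly h4 h6 hk, eval_cubicPoly h4 h6 hk, sub_eq_zero]
  exact h _ (by simpa using hT.trans_lt ht) hne z

/-- The `i`-th coefficient of the form `∑ j, c j * x ^ (d - j)` of degree `d` after the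
substitution `x ↦ x + r`. -/
def shiftCoeff {F : Type*} [CommRing F] (c : ℕ → F) (d : ℕ) (r : F) (i : ℕ) : F :=
  ∑ j ∈ Finset.range (i + 1), c j * (Nat.choose (d - j) (d - i) : F) * r ^ (i - j)

/-- The parametrization by `quadraticPoly` and `cubicPoly` hits every pair of a binary quadratic and
a binary cubic, in the two forms obtained by shifting the variable by `t` and by `s` so as to remove
the subleading coefficient of the quadratic and of the cubic, respectively. -/
theorem exists_aeval_quadraticPoly_cubicPoly {F : Type*} [Field F] [Algebra ℂ F]
    {α β : ℕ → F} {t s : F} (hdisc : (12 * α 0) ^ 3 - (216 * β 0) ^ 2 ≠ 0)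
    (ht : α 1 = -2 * α 0 * t) (hs : β 1 = -3 * β 0 * s) :
    ∃ x : Fin 6 → F,
      (fun i ↦ aeval x (quadraticPoly i)) =
        ![shiftCoeff α 2 t 0, shiftCoeff α 2 t 2, shiftCoeff β 3 t 0, shiftCoeff β 3 t 1,
          shiftCoeff β 3 t 2, shiftCoeff β 3 t 3] ∧
      (fun i ↦ aeval x (cubicPoly i)) =
        ![shiftCoeff α 2 s 0, shiftCoeff α 2 s 1, shiftCoeff α 2 s 2, shiftCoeff β 3 s 0,
          shiftCoeff β 3 s 2, shiftCoeff β 3 s 3] := by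
  generalize hα₀ : α 0 = α₀ at *
  generalize hβ₀ : β 0 = β₀ at *
  generalize hα₂ : α 2 = α₂
  generalize hβ₂ : β 2 = β₂
  generalize hβ₃ : β 3 = β₃
  have : CharZero F := charZero_of_injective_algebraMap (algebraMap ℂ F).injective
  obtain ⟨D, hD⟩ : ∃ D, 1728 * D = (12 * α₀) ^ 3 - (216 * β₀) ^ 2 :=
    ⟨((12 * α₀) ^ 3 - (216 * β₀) ^ 2) / 1728, by field_simp⟩
  have hD0 : D ≠ 0 := by
    rintro rfl
    exact hdisc (by rw [← hD, mul_zero])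
  obtain ⟨k, hk⟩ : ∃ k, 72 * D * k = t - s := ⟨(t - s) / (72 * D), by field_simp⟩
  obtain rfl : s = t - 72 * D * k := by rw [hk, sub_sub_cancel]
  obtain ⟨u, hu⟩ : ∃ u, u = α₂ - α₀ * t ^ 2 - D * (12 * α₀) * (216 * β₀) ^ 2 * k ^ 2 / 4 := ⟨_, rfl⟩
  obtain ⟨v, hv⟩ : ∃ v, v = β₂ + 2 * (-3 * β₀ * (t - 72 * D * k)) * t + 3 * β₀ * t ^ 2 +
      (216 * β₀) ^ 3 * D * k ^ 2 / 24 := ⟨_, rfl⟩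
  obtain ⟨l, hl⟩ : ∃ l, 1728 * D * l = 24 * (216 * β₀) * u - 288 * (12 * α₀) * v :=
    ⟨(24 * (216 * β₀) * u - 288 * (12 * α₀) * v) / (1728 * D), by field_simp⟩
  obtain ⟨m, hm⟩ : ∃ m, 1728 * D * m = 24 * (12 * α₀) ^ 2 * u - 288 * (216 * β₀) * v :=
    ⟨(24 * (12 * α₀) ^ 2 * u - 288 * (216 * β₀) * v) / (1728 * D), by field_simp⟩
  have hu' : 24 * u = 12 * α₀ * m - 216 * β₀ * l := by
    refine mul_left_cancel₀ (mul_ne_zero (by norm_num : (1728 : F) ≠ 0) hD0) ?_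
    linear_combination 24 * u * hD - 12 * α₀ * hm + 216 * β₀ * hl
  have hv' : 288 * v = 216 * β₀ * m - (12 * α₀) ^ 2 * l := by
    refine mul_left_cancel₀ (mul_ne_zero (by norm_num : (1728 : F) ≠ 0) hD0) ?_
    linear_combination 288 * v * hD - 216 * β₀ * hm + (12 * α₀) ^ 2 * hl
  obtain ⟨n, hn⟩ : ∃ n, D * n = 4 * (β₃ + β₂ * t - 3 * β₀ * (t - 72 * D * k) * t ^ 2 +
      β₀ * t ^ 3 + D ^ 2 * (216 * β₀) ^ 3 * k ^ 3) - D * (216 * β₀) * k * m :=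
    ⟨_, mul_div_cancel₀ _ hD0⟩
  have hnum (a : ℕ) [a.AtLeastTwo] : algebraMap ℂ F (OfNat.ofNat a) = OfNat.ofNat a :=
    map_ofNat _ a
  have hdiscPoly : aeval ![12 * α₀, 216 * β₀, k, l, m, n] discPoly = D := by
    simp [discPoly, hnum, ← hD]
  refine ⟨![12 * α₀, 216 * β₀, k, l, m, n], ?_, ?_⟩
  · ext i
    fin_cases i <;>
      simp [quadraticPoly, hdiscPoly, hnum, shiftCoeff, Finset.sum_range_succ, ht, hs, hα₀, hα₂,
        hβ₀, hβ₂, hβ₃]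
    · linear_combination hu - hu' / 24
    · ring
    · linear_combination hv - hv' / 288
    · linear_combination hn / 4
  · ext i
    fin_cases i <;>
      simp [cubicPoly, hdiscPoly, hnum, shiftCoeff, Finset.sum_range_succ, ht, hs, hα₀, hα₂, hβ₀,
        hβ₂, hβ₃]
    · ring
    · linear_combination hu - hu' / 24 - 12 * α₀ * D * k ^ 2 / 4 * hD
    · linear_combination hv - hv' / 288 + 216 * β₀ * D * k ^ 2 / 24 * hD
    · linear_combination hn / 4 - 72 * D * k * (hv - hv' / 288) -
        2 * 216 * β₀ * D ^ 2 * k ^ 3 * hD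

/-- If `P(a0,a2,b0,b1,b2,b3) = Q(c0,c1,c2,d0,d2,d3)` as functions of `(τ,z)` (for all `τ ∈ ℍ`
with `E4(τ)·E6(τ) ≠ 0` and all `z ∈ ℂ⁴`), then `P(â0,â2,b̂0,b̂1,b̂2,b̂3) =
Q(ĉ0,ĉ1,ĉ2,d̂0,d̂2,d̂3)` holds in the ring `R`. -/
theorem stmt_15 (P Q : MvPolynomial (Fin 6) ℂ)
    (h : ∀ τ : ℂ, 0 < τ.im → E4 τ * E6 τ ≠ 0 → ∀ z : Fin 4 → ℂ,
      MvPolynomial.eval (![a0f τ, a2f τ z, b0f τ, b1f τ z, b2f τ z, b3f τ z]) P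
        = MvPolynomial.eval (![c0f τ, c1f τ z, c2f τ z, d0f τ, d2f τ z, d3f τ z]) Q) :
    MvPolynomial.aeval (![ahat 0, ahat 2, bhat 0, bhat 1, bhat 2, bhat 3] : Fin 6 → Frac) P
      = MvPolynomial.aeval (![chat 0, chat 1, chat 2, dhat 0, dhat 2, dhat 3] : Fin 6 → Frac) Q
    := by
  have hinj := IsFractionRing.injective (MvPolynomial (Fin 7) ℂ) Frac
  have hα : alph 0 ≠ 0 := (map_ne_zero_iff _ hinj).mpr (X_ne_zero 0)
  have hβ : bet 0 ≠ 0 := (map_ne_zero_iff _ hinj).mpr (X_ne_zero 3)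
  have hdisc : (12 * alph 0) ^ 3 - (216 * bet 0) ^ 2 ≠ 0 := by
    have hX : (12 * X 0) ^ 3 - (216 * X 3) ^ 2 ≠ (0 : MvPolynomial (Fin 7) ℂ) := fun h0 ↦ by
      simpa using congrArg (eval ![1, 0, 0, 0, 0, 0, 0]) h0
    have hF := (map_ne_zero_iff _ hinj).mpr hX
    rwa [map_sub, map_pow, map_pow, map_mul, map_mul, map_ofNat, map_ofNat] at hF
  obtain ⟨x, hx, hy⟩ := exists_aeval_quadraticPoly_cubicPoly hdisc
    (t := -alph 1 / (2 * alph 0)) (s := -bet 1 / (3 * bet 0)) (by field_simp) (by field_simp)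
  change aeval ![shiftCoeff alph 2 _ 0, shiftCoeff alph 2 _ 2, shiftCoeff bet 3 _ 0,
      shiftCoeff bet 3 _ 1, shiftCoeff bet 3 _ 2, shiftCoeff bet 3 _ 3] P =
    aeval ![shiftCoeff alph 2 _ 0, shiftCoeff alph 2 _ 1, shiftCoeff alph 2 _ 2,
      shiftCoeff bet 3 _ 0, shiftCoeff bet 3 _ 2, shiftCoeff bet 3 _ 3] Q
  rw [← hx, ← hy, ← comp_aeval_apply, ← comp_aeval_apply,
    aeval_quadraticPoly_eq_aeval_cubicPoly h]
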